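/- Let m = 2q+1 ≥ 3 be odd and let μ be an integer with 2 ≤ μ ≤ m−2 such that m is coprime with each of μ−1, μ, and μ+1. For i = 1,…,q let x_i ∈ ℤ/m be the unique solution of (μ−1)·x_i = i, and set E(μ) = [(x_1, μ·x_1),…,(x_q, μ·x_q)] and E′(μ) = [(−μ·x_1, −x_1),…,(−μ·x_q, −x_q)]. Then (E(μ), E′(μ)) is a special pair of disjoint pseudostarters in ℤ/m: each is a pseudostarter, the multiset union of all their components contains every nonzero element of ℤ/m exactly twice, and no ordered pair of E(μ) equals any ordered pair of E′(μ). -/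

import Mathlib

/-- A pseudostarter in `ℤ/m`, `m = 2q+1`: a list of `q` pairs `(a d, b d)`,
`d = 1,…,q`, such that the `2q` differences `±(b d − a d)` comprise `ℤ/m ∖ {0}`. -/
def IsPseudostarter (q : ℕ) (a b : ℕ → ZMod (2*q+1)) : Prop :=
  ∀ z : ZMod (2*q+1), z ≠ 0 ↔ ∃ d, 1 ≤ d ∧ d ≤ q ∧ (b d - a d = z ∨ a d - b d = z)

theorem natCast_eq_iff_of_mem_Icc {q i : ℕ} (hi : i ∈ Finset.Icc 1 q) (z : ZMod (2*q+1)) :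
    (i : ZMod (2*q+1)) = z ↔ i = z.val := by
  rw [Finset.mem_Icc] at hi
  constructor
  · rintro rfl
    rw [ZMod.val_natCast, Nat.mod_eq_of_lt (by omega)]
  · rintro h
    rw [h, ZMod.natCast_zmod_val]

/-- The multiples `±u·i`, `1 ≤ i ≤ q`, of a unit `u` run over the nonzero residues modulo `2q+1`,
each occurring once. -/
theorem card_filter_unit_mul_add_card_filter_neg {q : ℕ} {u : ZMod (2*q+1)} (hu : IsUnit u)
    (c : ZMod (2*q+1)) :
    ((Finset.Icc 1 q).filter (fun i : ℕ => u * i = c)).card +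
      ((Finset.Icc 1 q).filter (fun i : ℕ => -(u * i) = c)).card = if c = 0 then 0 else 1 := by
  obtain ⟨z, rfl⟩ : ∃ z, u * z = c := ⟨hu.unit⁻¹ * c, by simp [← mul_assoc]⟩
  have h₁ : (Finset.Icc 1 q).filter (fun i : ℕ => u * i = u * z) =
      (Finset.Icc 1 q).filter (fun i : ℕ => i = z.val) :=
    Finset.filter_congr fun i hi => by
      rw [hu.mul_right_inj, natCast_eq_iff_of_mem_Icc hi]
  have h₂ : (Finset.Icc 1 q).filter (fun i : ℕ => -(u * i) = u * z) =
      (Finset.Icc 1 q).filter (fun i : ℕ => i = (-z).val) :=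
    Finset.filter_congr fun i hi => by
      rw [neg_eq_iff_eq_neg, ← mul_neg, hu.mul_right_inj, natCast_eq_iff_of_mem_Icc hi]
  rw [h₁, h₂, Finset.filter_eq', Finset.filter_eq', ZMod.neg_val]
  simp only [hu.mul_right_eq_zero]
  have hlt := z.val_lt
  by_cases hz : z = 0
  · simp [hz]
  · have hpos := ZMod.val_pos.2 hz
    simp only [hz, if_false, Finset.mem_Icc]
    split_ifs <;> simp <;> omega

theorem ne_zero_iff_exists_natCast_eq_or_neg_eq {q : ℕ} (z : ZMod (2*q+1)) :
    z ≠ 0 ↔ ∃ d : ℕ, 1 ≤ d ∧ d ≤ q ∧ ((d : ZMod (2*q+1)) = z ∨ -(d : ZMod (2*q+1)) = z) := by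
  have h := card_filter_unit_mul_add_card_filter_neg isUnit_one z
  simp only [one_mul] at h
  constructor
  · intro hz
    rw [if_neg hz] at h
    by_contra! hne
    rw [Finset.filter_false_of_mem fun i hi =>
        (hne i (Finset.mem_Icc.1 hi).1 (Finset.mem_Icc.1 hi).2).1,
      Finset.filter_false_of_mem fun i hi =>
        (hne i (Finset.mem_Icc.1 hi).1 (Finset.mem_Icc.1 hi).2).2] at h
    simp at h
  · rintro ⟨d, hd₁, hd₂, hd⟩ rfl
    simp only [if_true, Nat.add_eq_zero_iff, Finset.card_eq_zero,
      Finset.filter_eq_empty_iff] at h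
    have hmem := Finset.mem_Icc.2 ⟨hd₁, hd₂⟩
    exact hd.elim (h.1 hmem) (h.2 hmem)

theorem isPseudostarter_of_sub_eq {q : ℕ} {a b : ℕ → ZMod (2*q+1)}
    (h : ∀ d, 1 ≤ d → d ≤ q → b d - a d = (d : ZMod (2*q+1))) : IsPseudostarter q a b := by
  intro z
  rw [ne_zero_iff_exists_natCast_eq_or_neg_eq]
  refine exists_congr fun d => and_congr_right fun h₁ => and_congr_right fun h₂ => ?_
  rw [← neg_sub (b d), h d h₁ h₂]

/-- Corollary `cor:case3` (a): if `m = 2q+1` is coprime with each of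
`μ−1`, `μ`, `μ+1` and `x i` solves `(μ−1)·x i = i`, then
`(E(μ), E′(μ)) = ([(x i, μ·x i)], [(−μ·x i, −x i)])` is a special pair of disjoint
pseudostarters: each is a pseudostarter, every nonzero element of `ℤ/m` occurs
exactly twice among their components, and no ordered pair of `E(μ)` equals an
ordered pair of `E′(μ)`. -/
theorem stmt17 (q μ : ℕ) (hq : 1 ≤ q) (hμ2 : 2 ≤ μ) (hμm : μ ≤ 2*q-1)
    (hcop1 : Nat.Coprime (μ - 1) (2*q+1)) (hcop : Nat.Coprime μ (2*q+1))
    (hcop2 : Nat.Coprime (μ + 1) (2*q+1))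
    (x : ℕ → ZMod (2*q+1))
    (hx : ∀ i, 1 ≤ i → i ≤ q →
      ((μ : ZMod (2*q+1)) - 1) * x i = (i : ZMod (2*q+1))) :
    IsPseudostarter q (fun i => x i) (fun i => (μ : ZMod (2*q+1)) * x i) ∧
    IsPseudostarter q (fun i => -((μ : ZMod (2*q+1)) * x i)) (fun i => -(x i)) ∧
    (∀ c : ZMod (2*q+1),
      (((Finset.Icc 1 q) ×ˢ (Finset.univ : Finset (Fin 2 × Bool))).filter
        (fun p =>
          (if p.2.1 = (0 : Fin 2) then
            (if p.2.2 then (μ : ZMod (2*q+1)) * x p.1 else x p.1)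
          else
            (if p.2.2 then -(x p.1) else -((μ : ZMod (2*q+1)) * x p.1))) = c)).card
        = if c = 0 then 0 else 2) ∧
    (∀ i j, 1 ≤ i → i ≤ q → 1 ≤ j → j ≤ q →
      (x i, (μ : ZMod (2*q+1)) * x i)
        ≠ (-((μ : ZMod (2*q+1)) * x j), -(x j))) := by
  set M : ZMod (2*q+1) := (μ : ZMod (2*q+1))
  have hu : IsUnit M := (ZMod.isUnit_iff_coprime μ (2*q+1)).2 hcop
  have hu₁ : IsUnit (M - 1) := by
    have := (ZMod.isUnit_iff_coprime (μ - 1) (2*q+1)).2 hcop1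
    rwa [Nat.cast_sub (by omega), Nat.cast_one] at this
  have hu₂ : IsUnit (M + 1) := by
    have := (ZMod.isUnit_iff_coprime (μ + 1) (2*q+1)).2 hcop2
    rwa [Nat.cast_add, Nat.cast_one] at this
  obtain ⟨v, hv⟩ := hu₁.exists_right_inv
  have hv' : IsUnit v := IsUnit.of_mul_eq_one_right _ hv
  have hxv : ∀ i ∈ Finset.Icc 1 q, x i = v * i := fun i hi => by
    rw [Finset.mem_Icc] at hi
    linear_combination v * hx i hi.1 hi.2 - x i * hv
  refine ⟨isPseudostarter_of_sub_eq fun d h₁ h₂ => by linear_combination hx d h₁ h₂,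
    isPseudostarter_of_sub_eq fun d h₁ h₂ => by linear_combination hx d h₁ h₂, fun c => ?_, ?_⟩
  · have hcount := card_filter_unit_mul_add_card_filter_neg hv' c
    have hcount' := card_filter_unit_mul_add_card_filter_neg (hu.mul hv') c
    simp only [mul_assoc] at hcount'
    rw [Finset.card_filter, Finset.sum_product]
    simp only [Fintype.sum_prod_type, Fin.sum_univ_two, Fintype.sum_bool, if_true,
      Bool.false_eq_true, if_false, one_ne_zero]
    rw [Finset.sum_congr rfl fun i hi => by simp only [hxv i hi]; rfl]
    simp only [Finset.sum_add_distrib, ← Finset.card_filter]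
    split_ifs at hcount hcount' ⊢ <;> omega
  · intro i j hi₁ hi₂ hj₁ hj₂ h
    obtain ⟨h₁, h₂⟩ := Prod.mk.inj h
    have hij : (i : ZMod (2*q+1)) = j := by
      linear_combination h₂ - h₁ - hx i hi₁ hi₂ + hx j hj₁ hj₂
    have hxij : x i = x j :=
      hu₁.mul_left_cancel (by rw [hx i hi₁ hi₂, hx j hj₁ hj₂, hij])
    have hxi : x i = 0 := hu₂.mul_right_eq_zero.1 (by
      linear_combination h₁ + M * hxij)
    refine (ne_zero_iff_exists_natCast_eq_or_neg_eq (i : ZMod (2*q+1))).2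
      ⟨i, hi₁, hi₂, Or.inl rfl⟩ ?_
    rw [← hx i hi₁ hi₂, hxi, mul_zero]
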